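/- For every positive integer k divisible by 3, there exists a cyclic 3-distinguishable sequence over [k] of length C(k+2, 3) − k/3. Consequently, M_3^c(k) = C(k+2,3) − k/3 for all k divisible by 3. -/

import Mathlib

/-- The multiset of `m` cyclically consecutive elements (indices mod `M`). -/
def cwindow {α : Type*} (s : ℕ → α) (M m t : ℕ) : Multiset α :=
  (Multiset.range m).map (fun i => s ((t + i) % M))

/-- `s` is a cyclic `m`-distinguishable sequence of length `M`. -/
def IsCyclicDist {α : Type*} (M m : ℕ) (s : ℕ → α) : Prop :=
  ∀ t₁ t₂, t₁ < M → t₂ < M → cwindow s M m t₁ = cwindow s M m t₂ → t₁ = t₂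

namespace CycThree

/-! ### Upper bound -/

theorem cwindow_eq {α : Type*} (s : ℕ → α) (M t : ℕ) :
    cwindow s M 3 t = {s (t % M), s ((t + 1) % M), s ((t + 2) % M)} := by
  have : Multiset.range 3 = {0, 1, 2} := by decide
  rw [cwindow, this]
  rfl

theorem sum_shift (M i : ℕ) (f : ℕ → ℕ) :
    ∑ t ∈ Finset.range M, f ((t + i) % M) = ∑ t ∈ Finset.range M, f t := by
  rcases Nat.eq_zero_or_pos M with h | h
  · subst h; simp
  · induction i with
    | zero =>
      apply Finset.sum_congr rfl
      intro t ht
      rw [Finset.mem_range] at ht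
      rw [Nat.add_zero, Nat.mod_eq_of_lt ht]
    | succ i ih =>
      rw [← ih]
      have h1 := Finset.sum_range_succ (fun t => f ((t + i) % M)) M
      have h2 := Finset.sum_range_succ' (fun t => f ((t + i) % M)) M
      have h3 : (M + i) % M = (0 + i) % M := by simp
      simp only [h3] at h1
      have h4 : ∀ t, t + 1 + i = t + (i + 1) := by intro t; omega
      simp only [h4] at h2
      omega

theorem count_total (k : ℕ) (i j : Fin k) :
    ∑ m : Sym (Fin k) 3, (m : Multiset (Fin k)).count i
      = ∑ m : Sym (Fin k) 3, (m : Multiset (Fin k)).count j := by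
  refine Fintype.sum_equiv (Sym.equivCongr (Equiv.swap i j)) _ _ ?_
  intro m
  have : ((Sym.equivCongr (Equiv.swap i j) m : Sym (Fin k) 3) : Multiset (Fin k))
      = (m : Multiset (Fin k)).map (Equiv.swap i j) := rfl
  rw [this]
  have h := Multiset.count_map_eq_count' (Equiv.swap i j) (m : Multiset (Fin k))
    (Equiv.injective _) i
  rw [Equiv.swap_apply_left] at h
  exact h.symm

theorem sum_count (k : ℕ) (m : Sym (Fin k) 3) :
    ∑ i : Fin k, (m : Multiset (Fin k)).count i = 3 := by
  rw [Multiset.sum_count_eq_card (by simp)]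
  exact m.2

theorem total_mod (k : ℕ) (hdvd : 3 ∣ k) (i : Fin k) :
    (∑ m : Sym (Fin k) 3, (m : Multiset (Fin k)).count i) % 3 = 1 := by
  set T := ∑ m : Sym (Fin k) 3, (m : Multiset (Fin k)).count i with hT
  have h1 : ∑ j : Fin k, ∑ m : Sym (Fin k) 3, (m : Multiset (Fin k)).count j = k * T := by
    rw [Finset.sum_congr rfl (fun j _ => count_total k j i)]
    simp [hT]
  rw [Finset.sum_comm] at h1
  simp only [sum_count] at h1
  rw [Finset.sum_const, Finset.card_univ, Sym.card_sym_eq_choose, Fintype.card_fin] at h1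
  have h2 : (k + 2).choose 3 * 6 = (k + 2) * (k + 1) * k := by
    have := Nat.descFactorial_eq_factorial_mul_choose (k + 2) 3
    simp [Nat.descFactorial, Nat.factorial] at this
    linarith
  have hk : 0 < k := Nat.lt_of_le_of_lt (Nat.zero_le _) i.2
  have h3 : 2 * T = (k + 2) * (k + 1) := by
    apply Nat.eq_of_mul_eq_mul_left hk
    have : k + 3 - 1 = k + 2 := by omega
    rw [this] at h1
    simp only [smul_eq_mul] at h1
    linarith
  obtain ⟨c, rfl⟩ := hdvd
  have : 2 * T = 3 * (3 * c * c + 3 * c) + 2 := by rw [h3]; ring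
  omega

theorem upper (k : ℕ) (hdvd : 3 ∣ k) (M : ℕ) (s : ℕ → Fin k)
    (hs : IsCyclicDist M 3 s) : M ≤ (k + 2).choose 3 - k / 3 := by
  let w : ℕ → Sym (Fin k) 3 := fun t => ⟨cwindow s M 3 t, by simp [cwindow]⟩
  have hinj : Set.InjOn w (Finset.range M) := by
    intro a ha b hb hab
    simp only [Finset.coe_range, Set.mem_Iio] at ha hb
    exact hs a b ha hb (congrArg Subtype.val hab)
  let W := (Finset.range M).image w
  have hW : W.card = M := by
    rw [Finset.card_image_of_injOn hinj, Finset.card_range]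
  have hWc : ∀ i : Fin k, (∑ m ∈ W, (m : Multiset (Fin k)).count i) % 3 = 0 := by
    intro i
    rw [Finset.sum_image hinj]
    have : ∀ t, ((w t : Sym (Fin k) 3) : Multiset (Fin k)).count i
        = (if i = s ((t + 0) % M) then 1 else 0) + (if i = s ((t + 1) % M) then 1 else 0)
          + (if i = s ((t + 2) % M) then 1 else 0) := by
      intro t
      change (cwindow s M 3 t).count i = _
      rw [cwindow_eq]
      simp only [Multiset.insert_eq_cons, Multiset.count_cons, Multiset.count_singleton,
        Nat.add_zero]
      omega
    simp only [this, Finset.sum_add_distrib]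
    rw [sum_shift M 0 (fun t => if i = s t then 1 else 0),
      sum_shift M 1 (fun t => if i = s t then 1 else 0),
      sum_shift M 2 (fun t => if i = s t then 1 else 0)]
    omega
  have hO : ∀ i : Fin k, 1 ≤ ∑ m ∈ Wᶜ, (m : Multiset (Fin k)).count i := by
    intro i
    have h1 := total_mod k hdvd i
    have h2 := hWc i
    rw [← Finset.sum_add_sum_compl W] at h1
    omega
  have h3 : k ≤ 3 * Wᶜ.card := by
    calc k = ∑ i : Fin k, 1 := by simp
      _ ≤ ∑ i : Fin k, ∑ m ∈ Wᶜ, (m : Multiset (Fin k)).count i :=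
        Finset.sum_le_sum (fun i _ => hO i)
      _ = 3 * Wᶜ.card := by
        rw [Finset.sum_comm]
        simp only [sum_count]
        simp [mul_comm]
  have h4 := Finset.card_add_card_compl W
  rw [Sym.card_sym_eq_choose, Fintype.card_fin, hW] at h4
  have : k + 3 - 1 = k + 2 := by omega
  rw [this] at h4
  omega

/-! ### Joining cycles: a directed Euler circuit theorem -/

theorem euler {E V : Type*} [Fintype E] [DecidableEq E] (hd tl : E → V) (e₀ : E)
    (σ₀ : Equiv.Perm E) (h₀ : ∀ e, tl (σ₀ e) = hd e)
    (conn : ∀ S : Set E, e₀ ∈ S → (∀ e f, hd e = tl f → (e ∈ S ↔ f ∈ S)) → ∀ e, e ∈ S) :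
    ∃ σ : Equiv.Perm E, (∀ e, tl (σ e) = hd e) ∧ ∀ e, σ.SameCycle e₀ e := by
  classical
  let orb : Equiv.Perm E → Finset E := fun σ => Finset.univ.filter (fun e => σ.SameCycle e₀ e)
  obtain ⟨σ, hσ, hmax⟩ := Finset.exists_max_image
    (Finset.univ.filter (fun σ : Equiv.Perm E => ∀ e, tl (σ e) = hd e))
    (fun σ => (orb σ).card) ⟨σ₀, by simpa using h₀⟩
  simp only [Finset.mem_filter, Finset.mem_univ, true_and] at hσ hmax
  refine ⟨σ, hσ, ?_⟩
  have key : ∀ e f, hd e = hd f → σ.SameCycle e₀ e → σ.SameCycle e₀ f := by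
    intro e f hef he
    by_contra hf
    let τ : Equiv.Perm E := σ * Equiv.swap e f
    have hτe : τ e = σ f := by simp [τ]
    have hτf : τ f = σ e := by simp [τ]
    have hτ : ∀ g, g ≠ e → g ≠ f → τ g = σ g := by
      intro g h1 h2
      simp [τ, Equiv.swap_apply_of_ne_of_ne h1 h2]
    have hval : ∀ g, tl (τ g) = hd g := by
      intro g
      by_cases h1 : g = e
      · rw [h1, hτe, hσ, hef]
      by_cases h2 : g = f
      · rw [h2, hτf, hσ, hef]
      rw [hτ g h1 h2, hσ]
    have hne : ∀ n : ℕ, (σ ^ n) f ≠ e := by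
      intro n hn
      apply hf
      have : σ.SameCycle f e := ⟨n, by simpa using hn⟩
      exact he.trans this.symm
    have hfO : τ.SameCycle e f := by
      by_contra hfn
      have hstep : ∀ n : ℕ, τ.SameCycle e ((σ ^ (n + 1)) f) := by
        intro n
        induction n with
        | zero =>
          rw [zero_add, pow_one, ← hτe]
          exact Equiv.Perm.sameCycle_apply_right.2 (Equiv.Perm.SameCycle.refl _ _)
        | succ n ih =>
          have h1 : (σ ^ (n + 1)) f ≠ f := fun h => hfn (h ▸ ih)
          rw [pow_succ', Equiv.Perm.mul_apply, ← hτ _ (hne _) h1]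
          exact Equiv.Perm.sameCycle_apply_right.2 ih
      have h2 := hstep (orderOf σ - 1)
      have h3 : orderOf σ - 1 + 1 = orderOf σ := Nat.sub_add_cancel (orderOf_pos σ)
      rw [h3, pow_orderOf_eq_one] at h2
      exact hfn h2
    have hcl : ∀ g, τ.SameCycle e g → τ.SameCycle e (σ g) := by
      intro g hg
      by_cases h1 : g = e
      · rw [h1, ← hτf]
        exact Equiv.Perm.sameCycle_apply_right.2 hfO
      by_cases h2 : g = f
      · rw [h2, ← hτe]
        exact Equiv.Perm.sameCycle_apply_right.2 (Equiv.Perm.SameCycle.refl _ _)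
      rw [← hτ g h1 h2]
      exact Equiv.Perm.sameCycle_apply_right.2 hg
    have hcl2 : ∀ g, σ.SameCycle e g → τ.SameCycle e g := by
      intro g hg
      obtain ⟨n, hn⟩ := hg.exists_nat_pow_eq
      rw [← hn]
      clear hn
      induction n with
      | zero => exact Equiv.Perm.SameCycle.refl _ _
      | succ n ih =>
        rw [pow_succ', Equiv.Perm.mul_apply]
        exact hcl _ ih
    have h0 : τ.SameCycle e₀ e := (hcl2 e₀ he.symm).symm
    have hlt : (orb σ).card < (orb τ).card := by
      apply Finset.card_lt_card
      rw [Finset.ssubset_iff_of_subset]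
      · exact ⟨f, by simpa [orb] using h0.trans hfO, by simpa [orb] using hf⟩
      · intro g hg
        simp only [orb, Finset.mem_filter, Finset.mem_univ, true_and] at hg ⊢
        exact h0.trans (hcl2 g (he.symm.trans hg))
    exact absurd (hmax τ hval) (not_le.2 hlt)
  apply conn {e | σ.SameCycle e₀ e}
  · exact Equiv.Perm.SameCycle.refl _ _
  · intro e f hef
    have h1 : hd (σ.symm f) = tl f := by
      rw [← hσ, Equiv.apply_symm_apply]
    have h2 : σ.SameCycle e₀ (σ.symm f) ↔ σ.SameCycle e₀ f := by
      conv_rhs => rw [← Equiv.apply_symm_apply σ f]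
      exact Equiv.Perm.sameCycle_apply_right.symm
    constructor
    · intro he
      exact h2.1 (key e _ (by rw [h1, hef]) he)
    · intro hf
      exact key _ e (by rw [h1, hef]) (h2.2 hf)

/-! ### The construction -/

/-- Cyclic difference. -/
def dif (k a b : ℕ) : ℕ := if a ≤ b then b - a else b + k - a

/-- Asymmetric part of the admissible relation between consecutive differences. -/
def Q (k x y : ℕ) : Prop :=
  (x = y ∧ 2 * x ≤ k ∧ 3 * x ≠ k) ∨ (x = 0 ∧ 0 < y ∧ 2 * y < k) ∨
    (0 < x ∧ x < y ∧ 2 * x + y < k ∧ k < x + 2 * y ∧ x + y < k)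

/-- Admissible consecutive differences. -/
def R (k x y : ℕ) : Prop := Q k x y ∨ Q k y x

/-- Chosen ordered triples. -/
def P (k a b c : ℕ) : Prop := R k (dif k a b) (dif k b c)

theorem R_symm {k x y : ℕ} (h : R k x y) : R k y x := h.symm

theorem dif_cases (k a b : ℕ) : (a ≤ b ∧ dif k a b + a = b) ∨ (b < a ∧ (a ≤ b + k → dif k a b + a = b + k)) := by
  unfold dif
  split_ifs <;> omega

theorem P_inj1 {k a b c : ℕ} (ha : a < k) (hb : b < k) (hc : c < k)
    (h : P k a b c) (h' : P k a c b) : b = c := by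
  unfold P R Q at h h'
  have h1 := dif_cases k a b
  have h2 := dif_cases k b c
  have h3 := dif_cases k a c
  have h4 := dif_cases k c b
  generalize dif k a b = x at *
  generalize dif k b c = y at *
  generalize dif k a c = z at *
  generalize dif k c b = w at *
  omega

theorem P_inj2 {k a b c : ℕ} (ha : a < k) (hb : b < k) (hc : c < k)
    (h : P k a b c) (h' : P k b a c) : a = b := by
  unfold P R Q at h h'
  have h1 := dif_cases k a b
  have h2 := dif_cases k b c
  have h3 := dif_cases k b a
  have h4 := dif_cases k a c
  generalize dif k a b = x at *
  generalize dif k b c = y at *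
  generalize dif k b a = z at *
  generalize dif k a c = w at *
  omega

theorem P_inj3 {k a b c : ℕ} (ha : a < k) (hb : b < k) (hc : c < k)
    (h : P k a b c) (h' : P k c b a) : a = c := by
  unfold P R Q at h h'
  have h1 := dif_cases k a b
  have h2 := dif_cases k b c
  have h3 := dif_cases k c b
  have h4 := dif_cases k b a
  generalize dif k a b = x at *
  generalize dif k b c = y at *
  generalize dif k c b = z at *
  generalize dif k b a = w at *
  omega

theorem P_inj4 {k a b c : ℕ} (ha : a < k) (hb : b < k) (hc : c < k)
    (h : P k a b c) (h' : P k b c a) : a = b ∧ b = c := by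
  unfold P R Q at h h'
  have h1 := dif_cases k a b
  have h2 := dif_cases k b c
  have h3 := dif_cases k c a
  generalize dif k a b = x at *
  generalize dif k b c = y at *
  generalize dif k c a = z at *
  omega

theorem Q_loop {k x y z : ℕ} (h : x + y + z = k) (h1 : x = y) (h2 : x ≠ z) : Q k x y :=
  Or.inl (by omega)

theorem Q_zero {k x y z : ℕ} (h : x + y + z = k) (h1 : x = 0) (h2 : 0 < y) (h3 : y < z) :
    Q k x y := Or.inr (Or.inl (by omega))

theorem Q_pos {k x y z : ℕ} (h : x + y + z = k) (h1 : 0 < x) (h2 : x < z) (h3 : z < y) :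
    Q k x y := Or.inr (Or.inr (by omega))

theorem R_surj {k x y z : ℕ} (h : x + y + z = k) (hz : 0 < z) :
    R k x y ∨ R k y z ∨ R k z x ∨ (x = y ∧ 3 * x = k) := by
  have hyz : y + z + x = k := by omega
  have hzx : z + x + y = k := by omega
  have hyx : y + x + z = k := by omega
  have hzy : z + y + x = k := by omega
  have hxz : x + z + y = k := by omega
  by_cases e1 : x = y
  · by_cases e2 : x = z
    · exact Or.inr (Or.inr (Or.inr (by omega)))
    · exact Or.inl (Or.inl (Q_loop h e1 e2))
  by_cases e2 : y = z
  · exact Or.inr (Or.inl (Or.inl (Q_loop hyz e2 (by omega))))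
  by_cases e3 : z = x
  · exact Or.inr (Or.inr (Or.inl (Or.inl (Q_loop hzx e3 (by omega)))))
  rcases Nat.eq_zero_or_pos x with hx | hx
  · rcases Nat.lt_or_gt_of_ne e2 with h1 | h1
    · exact Or.inl (Or.inl (Q_zero h hx (by omega) h1))
    · exact Or.inr (Or.inr (Or.inl (Or.inr (Q_zero hxz hx hz h1))))
  rcases Nat.eq_zero_or_pos y with hy | hy
  · rcases Nat.lt_or_gt_of_ne e3 with h1 | h1
    · exact Or.inr (Or.inl (Or.inl (Q_zero hyz hy hz h1)))
    · exact Or.inl (Or.inr (Q_zero hyx hy hx h1))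
  rcases Nat.lt_or_gt_of_ne e1 with h1 | h1 <;> rcases Nat.lt_or_gt_of_ne e2 with h2 | h2 <;>
    rcases Nat.lt_or_gt_of_ne e3 with h3 | h3
  · omega
  · exact Or.inr (Or.inr (Or.inl (Or.inr (Q_pos hxz hx h1 h2))))
  · exact Or.inr (Or.inl (Or.inr (Q_pos hzy hz h3 h1)))
  · exact Or.inl (Or.inl (Q_pos h hx h3 h2))
  · exact Or.inl (Or.inr (Q_pos hyx hy h2 h3))
  · exact Or.inr (Or.inl (Or.inl (Q_pos hyz hy h1 h3)))
  · exact Or.inr (Or.inr (Or.inl (Or.inl (Q_pos hzx hz h2 h1))))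
  · omega

theorem P_surj {k a b c : ℕ} (hab : a ≤ b) (hbc : b ≤ c) (hc : c < k) :
    P k a b c ∨ P k b c a ∨ P k c a b ∨ (a < k / 3 ∧ b = a + k / 3 ∧ c = a + 2 * (k / 3)) := by
  by_cases hac : a = c
  · left
    have : b = a := by omega
    subst hac; subst this
    unfold P R Q dif
    simp
    omega
  · have h1 : dif k a b = b - a := by simp [dif, hab]
    have h2 : dif k b c = c - b := by simp [dif, hbc]
    have h3 : dif k c a = a + k - c := by
      have : ¬ c ≤ a := by omega
      simp [dif, this]
    unfold P
    rw [h1, h2, h3]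
    rcases R_surj (k := k) (x := b - a) (y := c - b) (z := a + k - c) (by omega) (by omega)
      with h | h | h | h
    · exact Or.inl h
    · exact Or.inr (Or.inl h)
    · exact Or.inr (Or.inr (Or.inl h))
    · right; right; right
      omega

/-- The chosen triples. -/
abbrev E (k : ℕ) : Type := {p : Fin k × Fin k × Fin k // P k p.1 p.2.1 p.2.2}

/-- Multiset of a triple. -/
def ms {k : ℕ} (e : E k) : Multiset (Fin k) := {e.1.1, e.1.2.1, e.1.2.2}

theorem perm_three {α : Type*} [DecidableEq α] {a b c a' b' c' : α}
    (h : List.Perm [a, b, c] [a', b', c']) :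
    (a' = a ∧ b' = b ∧ c' = c) ∨ (a' = b ∧ b' = a ∧ c' = c) ∨ (a' = c ∧ b' = b ∧ c' = a) ∨
    (a' = b ∧ b' = c ∧ c' = a) ∨ (a' = c ∧ b' = a ∧ c' = b) ∨ (a' = a ∧ b' = c ∧ c' = b) := by
  have hm : a' ∈ [a, b, c] := h.mem_iff.2 (by simp)
  have two : ∀ p q r t : α, List.Perm [p, q] [r, t] → (r = p ∧ t = q) ∨ (r = q ∧ t = p) := by
    intro p q r t h2
    have hr : r ∈ [p, q] := h2.mem_iff.2 (by simp)
    simp only [List.mem_cons, List.not_mem_nil, or_false] at hr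
    rcases hr with rfl | rfl
    · have := List.perm_singleton.1 ((List.perm_cons r).1 h2).symm
      simp only [List.cons.injEq, and_true] at this
      exact Or.inl ⟨rfl, this⟩
    · have h3 := (List.Perm.swap p r []).trans h2
      have := List.perm_singleton.1 ((List.perm_cons r).1 h3).symm
      simp only [List.cons.injEq, and_true] at this
      exact Or.inr ⟨rfl, this⟩
  simp only [List.mem_cons, List.not_mem_nil, or_false] at hm
  rcases hm with rfl | rfl | rfl
  · rcases two _ _ _ _ ((List.perm_cons a').1 h) with h4 | h4
    · exact Or.inl ⟨rfl, h4⟩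
    · exact Or.inr (Or.inr (Or.inr (Or.inr (Or.inr ⟨rfl, h4⟩))))
  · have h3 := (List.Perm.swap a a' [c]).trans h
    rcases two _ _ _ _ ((List.perm_cons a').1 h3) with h4 | h4
    · exact Or.inr (Or.inl ⟨rfl, h4⟩)
    · exact Or.inr (Or.inr (Or.inr (Or.inl ⟨rfl, h4⟩)))
  · have h3 := (List.perm_append_comm (l₁ := [a']) (l₂ := [a, b])).trans h
    rcases two _ _ _ _ ((List.perm_cons a').1 h3) with h4 | h4
    · exact Or.inr (Or.inr (Or.inr (Or.inr (Or.inl ⟨rfl, h4⟩))))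
    · exact Or.inr (Or.inr (Or.inl ⟨rfl, h4.1, h4.2⟩))

theorem ms_inj {k : ℕ} (e f : E k) (h : ms e = ms f) : e = f := by
  obtain ⟨⟨a, b, c⟩, he⟩ := e
  obtain ⟨⟨a', b', c'⟩, hf⟩ := f
  simp only at he hf
  have h' : List.Perm [a, b, c] [a', b', c'] := Multiset.coe_eq_coe.1 h
  have ha := a.2
  have hb := b.2
  have hc := c.2
  apply Subtype.ext
  have hm := perm_three h'
  rcases hm with ⟨rfl, rfl, rfl⟩ | ⟨rfl, rfl, rfl⟩ | ⟨rfl, rfl, rfl⟩ | ⟨rfl, rfl, rfl⟩ |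
    ⟨rfl, rfl, rfl⟩ | ⟨rfl, rfl, rfl⟩
  · rfl
  · have := Fin.ext (P_inj2 ha hb hc he hf)
    subst this; rfl
  · have := Fin.ext (P_inj3 ha hb hc he hf)
    subst this; rfl
  · have := P_inj4 ha hb hc he hf
    have h1 := Fin.ext this.1
    have h2 := Fin.ext this.2
    subst h1; subst h2; rfl
  · have := P_inj4 hc ha hb hf he
    have h1 := Fin.ext this.1
    have h2 := Fin.ext this.2
    subst h1; subst h2; rfl
  · have := Fin.ext (P_inj1 ha hb hc he hf)
    subst this; rfl

/-- `c + d` reduced modulo `k`, for `c, d < k`. -/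
def radd (k c d : ℕ) : ℕ := if c + d < k then c + d else c + d - k

theorem dif_lt {k a b : ℕ} (ha : a < k) (hb : b < k) : dif k a b < k := by
  unfold dif; split_ifs <;> omega

theorem radd_lt {k c d : ℕ} (hc : c < k) (hd : d < k) : radd k c d < k := by
  unfold radd; split_ifs <;> omega

theorem dif_radd {k c d : ℕ} (hc : c < k) (hd : d < k) : dif k c (radd k c d) = d := by
  unfold dif radd; split_ifs <;> omega

theorem dif_inj {k a a' b : ℕ} (ha : a < k) (ha' : a' < k) (hb : b < k)
    (h : dif k a b = dif k a' b) : a = a' := by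
  unfold dif at h; split_ifs at h <;> omega

/-- Basic successor map. -/
def succ0 {k : ℕ} (e : E k) : E k :=
  ⟨(e.1.2.1, e.1.2.2, ⟨radd k e.1.2.2 (dif k e.1.1 e.1.2.1),
      radd_lt e.1.2.2.2 (dif_lt e.1.1.2 e.1.2.1.2)⟩), by
    have h : R k _ _ := e.2
    change R k _ (dif k _ (radd k _ _))
    rw [dif_radd e.1.2.2.2 (dif_lt e.1.1.2 e.1.2.1.2)]
    exact R_symm h⟩

theorem succ0_inj {k : ℕ} : Function.Injective (succ0 (k := k)) := by
  rintro ⟨⟨a, b, c⟩, he⟩ ⟨⟨a', b', c'⟩, hf⟩ h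
  simp only [succ0, Subtype.mk.injEq, Prod.mk.injEq, Fin.mk.injEq] at h
  obtain ⟨rfl, rfl, h3⟩ := h
  have h4 := congrArg (dif k c) h3
  rw [dif_radd c.2 (dif_lt a.2 b.2), dif_radd c.2 (dif_lt a'.2 b.2)] at h4
  have := Fin.ext (dif_inj a.2 a'.2 b.2 h4)
  subst this; rfl

theorem dif_self (k a : ℕ) : dif k a a = 0 := by simp [dif]

theorem conn (k : ℕ) (hk : 3 ≤ k) (hk3 : 3 ∣ k) (S : Set (E k)) (e₀ : E k)
    (h₀ : e₀.1 = (⟨0, by omega⟩, ⟨0, by omega⟩, ⟨0, by omega⟩)) (hS : e₀ ∈ S)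
    (hcl : ∀ e f : E k, (e.1.2.1, e.1.2.2) = (f.1.1, f.1.2.1) → (e ∈ S ↔ f ∈ S)) :
    ∀ e, e ∈ S := by
  have cl : ∀ (a b c d : Fin k) (h : P k a b c) (h' : P k b c d),
      ((⟨(a, b, c), h⟩ : E k) ∈ S ↔ (⟨(b, c, d), h'⟩ : E k) ∈ S) :=
    fun a b c d h h' => hcl _ _ rfl
  have Paaa : ∀ a : ℕ, P k a a a := by
    intro a
    unfold P R Q
    rw [dif_self]
    omega
  have Paab : ∀ a b : ℕ, 2 * dif k a b < k → P k a a b := by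
    intro a b h
    unfold P R Q
    rw [dif_self]
    omega
  have Pabb : ∀ a b : ℕ, 2 * dif k a b < k → P k a b b := by
    intro a b h
    unfold P R Q
    rw [dif_self]
    omega
  have hdiag : ∀ (n : ℕ) (hn : n < k), (⟨(⟨n, hn⟩, ⟨n, hn⟩, ⟨n, hn⟩), Paaa n⟩ : E k) ∈ S := by
    intro n
    induction n with
    | zero =>
      intro hn
      have : (⟨(⟨0, hn⟩, ⟨0, hn⟩, ⟨0, hn⟩), Paaa 0⟩ : E k) = e₀ := Subtype.ext h₀.symm
      rw [this]; exact hS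
    | succ n ih =>
      intro hn
      have hd : 2 * dif k n (n + 1) < k := by unfold dif; split_ifs <;> omega
      have hn' : n < k := by omega
      have h1 := (cl ⟨n, hn'⟩ ⟨n, hn'⟩ ⟨n, hn'⟩ ⟨n + 1, hn⟩ (Paaa n) (Paab _ _ hd)).1 (ih hn')
      have h2 := (cl ⟨n, hn'⟩ ⟨n, hn'⟩ ⟨n + 1, hn⟩ ⟨n + 1, hn⟩ _ (Pabb _ _ hd)).1 h1
      exact (cl ⟨n, hn'⟩ ⟨n + 1, hn⟩ ⟨n + 1, hn⟩ ⟨n + 1, hn⟩ _ (Paaa _)).1 h2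
  have hdiag' : ∀ a : Fin k, (⟨(a, a, a), Paaa a⟩ : E k) ∈ S := fun a => hdiag a.1 a.2
  have hx : ∀ (a b c : Fin k) (h : P k a b c), 2 * dif k a b < k → (⟨(a, b, c), h⟩ : E k) ∈ S := by
    intro a b c h hab
    have h1 := (cl a a a b (Paaa a) (Paab _ _ hab)).1 (hdiag' a)
    exact (cl a a b c _ h).1 h1
  have hy : ∀ (a b c : Fin k) (h : P k a b c), 2 * dif k b c < k → (⟨(a, b, c), h⟩ : E k) ∈ S := by
    intro a b c h hbc
    have h1 := (cl b c c c (Pabb _ _ hbc) (Paaa c)).2 (hdiag' c)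
    exact (cl a b c c h _).2 h1
  rintro ⟨⟨a, b, c⟩, h⟩
  by_cases h1 : 2 * dif k a b < k
  · exact hx a b c h h1
  by_cases h2 : 2 * dif k b c < k
  · exact hy a b c h h2
  have h3 : 2 * dif k b c = k := by
    have h' : P k a b c := h
    unfold P R Q at h'
    omega
  have h1k : 1 < k := by omega
  have hd : dif k c (radd k c 1) = 1 := dif_radd c.2 h1k
  have hP : P k b c (radd k c 1) := by
    unfold P R Q
    rw [hd]
    omega
  refine (cl a b c ⟨radd k c 1, radd_lt c.2 h1k⟩ h hP).2 (hy _ _ _ _ ?_)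
  rw [hd]; omega

theorem card_lower (k : ℕ) : (k + 2).choose 3 ≤ Nat.card (E k) + k / 3 := by
  classical
  let f : E k ⊕ Fin (k / 3) → Sym (Fin k) 3 := fun z => match z with
    | Sum.inl e => ⟨ms e, by simp [ms]⟩
    | Sum.inr a => ⟨{⟨a.1, by omega⟩, ⟨a.1 + k / 3, by omega⟩, ⟨a.1 + 2 * (k / 3), by omega⟩},
        by simp⟩
  have hf : Function.Surjective f := by
    have main : ∀ a b c : Fin k, a ≤ b → b ≤ c → ∃ z, (f z : Multiset (Fin k)) = {a, b, c} := by
      intro a b c hab hbc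
      rcases P_surj (k := k) (a := a) (b := b) (c := c) hab hbc c.2 with h | h | h | ⟨h1, h2, h3⟩
      · exact ⟨Sum.inl ⟨(a, b, c), h⟩, rfl⟩
      · refine ⟨Sum.inl ⟨(b, c, a), h⟩, ?_⟩
        change ((([b, c, a] : List (Fin k))) : Multiset (Fin k)) = (([a, b, c] : List (Fin k)))
        exact Multiset.coe_eq_coe.2 (List.perm_append_comm (l₁ := [b, c]) (l₂ := [a]))
      · refine ⟨Sum.inl ⟨(c, a, b), h⟩, ?_⟩
        change ((([c, a, b] : List (Fin k))) : Multiset (Fin k)) = (([a, b, c] : List (Fin k)))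
        exact Multiset.coe_eq_coe.2 (List.perm_append_comm (l₁ := [c]) (l₂ := [a, b]))
      · refine ⟨Sum.inr ⟨a, h1⟩, ?_⟩
        have hb : ∀ h, (⟨a + k / 3, h⟩ : Fin k) = b := fun _ => Fin.ext h2.symm
        have hc : ∀ h, (⟨a + 2 * (k / 3), h⟩ : Fin k) = c := fun _ => Fin.ext h3.symm
        change ({⟨a.1, _⟩, ⟨a.1 + k / 3, _⟩, ⟨a.1 + 2 * (k / 3), _⟩} : Multiset (Fin k)) = _
        rw [hb, hc]
    intro m
    have hl : ((m : Multiset (Fin k)).sort (· ≤ ·)).length = 3 := by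
      rw [Multiset.length_sort]; exact m.2
    have hs := Multiset.pairwise_sort (m : Multiset (Fin k)) (· ≤ ·)
    have he := Multiset.sort_eq (m : Multiset (Fin k)) (· ≤ ·)
    obtain ⟨a, b, c, habc⟩ := List.length_eq_three.1 hl
    rw [habc] at hs he
    simp only [List.pairwise_cons, List.mem_cons, List.not_mem_nil, or_false] at hs
    obtain ⟨z, hz⟩ := main a b c (hs.1 b (Or.inl rfl)) (hs.2.1 c rfl)
    exact ⟨z, Subtype.ext (hz.trans he)⟩
  have := Fintype.card_le_of_surjective f hf
  rw [Sym.card_sym_eq_choose, Fintype.card_fin, Fintype.card_sum, Fintype.card_fin] at this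
  rw [Nat.card_eq_fintype_card]
  exact this

theorem exists_seq (k : ℕ) (hk : 0 < k) (hdvd : 3 ∣ k) :
    ∃ s : ℕ → Fin k, IsCyclicDist (Nat.card (E k)) 3 s := by
  classical
  have hk3 : 3 ≤ k := Nat.le_of_dvd hk hdvd
  let e₀ : E k := ⟨(⟨0, hk⟩, ⟨0, hk⟩, ⟨0, hk⟩), by
    change R k (dif k 0 0) (dif k 0 0)
    unfold R Q
    rw [dif_self]
    omega⟩
  let σ₀ : Equiv.Perm (E k) := Equiv.ofBijective succ0 (Finite.injective_iff_bijective.1 succ0_inj)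
  obtain ⟨σ, hσ, hcyc⟩ := euler (fun e : E k => (e.1.2.1, e.1.2.2)) (fun e : E k => (e.1.1, e.1.2.1))
    e₀ σ₀ (fun e => rfl) (fun S hS hcl => conn k hk3 hdvd S e₀ rfl hS hcl)
  have hon : σ.IsCycleOn (Finset.univ : Finset (E k)) := by
    refine ⟨by simp, ?_⟩
    intro a _ b _
    exact (hcyc a).symm.trans (hcyc b)
  rw [Nat.card_eq_fintype_card]
  set M := Fintype.card (E k) with hM
  have hpow : ∀ m n : ℕ, (σ ^ m) e₀ = (σ ^ n) e₀ ↔ m ≡ n [MOD M] := by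
    intro m n
    exact hon.pow_apply_eq_pow_apply (Finset.mem_univ e₀)
  refine ⟨fun t => ((σ ^ t) e₀).1.1, ?_⟩
  have hmod : ∀ n : ℕ, (σ ^ (n % M)) e₀ = (σ ^ n) e₀ := fun n => (hpow _ _).2 (Nat.mod_modEq n M)
  have hw : ∀ t, cwindow (fun t => ((σ ^ t) e₀).1.1) M 3 t = ms ((σ ^ t) e₀) := by
    intro t
    rw [cwindow_eq]
    simp only [hmod]
    have h1 := hσ ((σ ^ t) e₀)
    have h2 := hσ (σ ((σ ^ t) e₀))
    simp only [Prod.mk.injEq] at h1 h2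
    have e1 : (σ ^ (t + 1)) e₀ = σ ((σ ^ t) e₀) := by rw [pow_succ', Equiv.Perm.mul_apply]
    have e2 : (σ ^ (t + 2)) e₀ = σ (σ ((σ ^ t) e₀)) := by
      rw [pow_succ', Equiv.Perm.mul_apply, e1]
    rw [e1, e2, h2.1, h1.1, h1.2]
    rfl
  intro t₁ t₂ h1 h2 h
  rw [hw, hw] at h
  have := (hpow _ _).1 (ms_inj _ _ h)
  exact Nat.ModEq.eq_of_lt_of_lt this h1 h2

end CycThree

/-- For every positive `k` divisible by `3` there is a cyclic 3-distinguishable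
sequence over `[k]` of length `C(k+2,3) - k/3`, and this is best possible:
`M_3^c(k) = C(k+2,3) - k/3`. -/
theorem stmt11 (k : ℕ) (hk : 0 < k) (hdvd : 3 ∣ k) :
    (∃ s : ℕ → Fin k, IsCyclicDist ((k + 2).choose 3 - k / 3) 3 s) ∧
    (∀ M : ℕ, ∀ s : ℕ → Fin k, IsCyclicDist M 3 s → M ≤ (k + 2).choose 3 - k / 3) := by
  obtain ⟨s, hs⟩ := CycThree.exists_seq k hk hdvd
  refine ⟨⟨s, ?_⟩, fun M s hs => CycThree.upper k hdvd M s hs⟩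
  have h1 := CycThree.upper k hdvd _ s hs
  have h2 := CycThree.card_lower k
  have h3 : (k + 2).choose 3 - k / 3 = Nat.card (CycThree.E k) := by omega
  rw [h3]
  exact hs
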